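/- Let F ∈ B(𝔥⊕𝔎) and let T ∈ B(𝔥⊕𝔎) be selfadjoint with T = Δ⊥TΔ⊥. Then F* ⋄ F ≤ T if and only if F ⋄ F* ≤ T. -/

import Mathlib

noncomputable section

open ContinuousLinearMap

namespace QS

variable (H K : Type*) [NormedAddCommGroup H] [InnerProductSpace ℂ H] [CompleteSpace H]
  [NormedAddCommGroup K] [InnerProductSpace ℂ K] [CompleteSpace K]

/-- The Hilbert space direct sum `𝔥 ⊕ 𝔎`. -/
abbrev E := WithLp 2 (H × K)

def eE : E H K ≃L[ℂ] H × K := WithLp.prodContinuousLinearEquiv 2 ℂ H K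

/-- Inclusion of `𝔥` into `𝔥 ⊕ 𝔎`. -/
def inH : H →L[ℂ] E H K := ((eE H K).symm : H × K →L[ℂ] E H K).comp (ContinuousLinearMap.inl ℂ H K)

/-- Inclusion of `𝔎` into `𝔥 ⊕ 𝔎`. -/
def inK : K →L[ℂ] E H K := ((eE H K).symm : H × K →L[ℂ] E H K).comp (ContinuousLinearMap.inr ℂ H K)

/-- Projection of `𝔥 ⊕ 𝔎` onto `𝔥`. -/
def prH : E H K →L[ℂ] H := (ContinuousLinearMap.fst ℂ H K).comp ((eE H K) : E H K →L[ℂ] H × K)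

/-- Projection of `𝔥 ⊕ 𝔎` onto `𝔎`. -/
def prK : E H K →L[ℂ] K := (ContinuousLinearMap.snd ℂ H K).comp ((eE H K) : E H K →L[ℂ] H × K)

/-- `Δ`, the orthogonal projection onto `{0} ⊕ 𝔎`. -/
def Dl : E H K →L[ℂ] E H K := (inK H K).comp (prK H K)

/-- `Δ⊥ = I - Δ`. -/
def Dp : E H K →L[ℂ] E H K := 1 - Dl H K

variable {H K}

/-- The series product `F₁ ⋄ F₂ := F₁ + F₁ Δ F₂ + F₂`. -/
def sp (F₁ F₂ : E H K →L[ℂ] E H K) : E H K →L[ℂ] E H K := F₁ + F₁ * Dl H K * F₂ + F₂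

/-- Operator order: `S ≤ T` iff `T - S` is a nonnegative selfadjoint operator. -/
def opLe (S T : E H K →L[ℂ] E H K) : Prop := (T - S).IsPositive

/-- `F` has block matrix form `[K, M; L, N]`, i.e. `F (u ⊕ ζ) = (K u + M ζ) ⊕ (L u + N ζ)`. -/
def HasBlock (F : E H K →L[ℂ] E H K) (Kc : H →L[ℂ] H) (M : K →L[ℂ] H)
    (L : H →L[ℂ] K) (N : K →L[ℂ] K) : Prop :=
  ∀ (u : H) (ζ : K), F ((WithLp.equiv 2 (H × K)).symm (u, ζ)) =
    (WithLp.equiv 2 (H × K)).symm (Kc u + M ζ, L u + N ζ)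

/-- The operator on `𝔥 ⊕ 𝔎` with block matrix form `[K, M; L, N]`. -/
def blockOf (Kc : H →L[ℂ] H) (M : K →L[ℂ] H) (L : H →L[ℂ] K) (N : K →L[ℂ] K) :
    E H K →L[ℂ] E H K :=
  (inH H K) ∘L Kc ∘L (prH H K) + (inH H K) ∘L M ∘L (prK H K) +
    (inK H K) ∘L L ∘L (prH H K) + (inK H K) ∘L N ∘L (prK H K)

theorem Dl_mul_Dl : Dl H K * Dl H K = Dl H K := by
  ext x
  all_goals simp [Dl, inK, prK]

theorem Dl_mul_Dp : Dl H K * Dp H K = 0 := by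
  rw [Dp, mul_sub, mul_one, Dl_mul_Dl, sub_self]

theorem Dp_mul_Dl : Dp H K * Dl H K = 0 := by
  rw [Dp, sub_mul, one_mul, Dl_mul_Dl, sub_self]

theorem isSelfAdjoint_Dl : IsSelfAdjoint (Dl H K) := by
  rw [ContinuousLinearMap.isSelfAdjoint_iff_isSymmetric]
  intro x y
  simp [Dl, inK, prK, eE, WithLp.prod_inner_apply]

theorem isPositive_Dl : (Dl H K).IsPositive := by
  have h := ContinuousLinearMap.isPositive_adjoint_comp_self (Dl H K)
  rwa [isSelfAdjoint_Dl.adjoint_eq, ← ContinuousLinearMap.mul_def, Dl_mul_Dl] at h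

theorem opLe_sp_adjoint_of_opLe_adjoint_sp {F T : E H K →L[ℂ] E H K}
    (hTz : T = Dp H K * T * Dp H K) (h : opLe (sp (adjoint F) F) T) :
    opLe (sp F (adjoint F)) T := by
  have hDT : Dl H K * T = 0 := by
    rw [hTz, ← mul_assoc, ← mul_assoc, Dl_mul_Dp, zero_mul, zero_mul]
  have hTD : T * Dl H K = 0 := by
    rw [hTz, mul_assoc, Dp_mul_Dl, mul_zero]
  have hS : adjoint (1 + F * Dl H K) = 1 + Dl H K * adjoint F := by
    simp only [← ContinuousLinearMap.star_eq_adjoint, star_add, star_one, star_mul,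
      isSelfAdjoint_Dl.star_eq]
  have hR : adjoint (sp F (adjoint F)) = sp F (adjoint F) := by
    simp only [sp, ← ContinuousLinearMap.star_eq_adjoint, star_add, star_mul, star_star,
      isSelfAdjoint_Dl.star_eq, mul_assoc]
    abel
  have hpos := (h.conj_adjoint (1 + F * Dl H K)).add
    (isPositive_Dl.conj_adjoint (sp F (adjoint F)))
  rw [hS, hR] at hpos
  simp only [← ContinuousLinearMap.mul_def] at hpos
  have hconj : (1 + F * Dl H K) * T * (1 + Dl H K * adjoint F) = T := by
    rw [add_mul, mul_assoc F, hDT, mul_add, mul_zero, add_zero, one_mul, ← mul_assoc, hTD]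
    simp
  unfold opLe
  convert hpos using 1
  rw [← mul_assoc, ← mul_assoc, mul_sub, sub_mul, hconj]
  simp only [sp]
  noncomm_ring

/-- For selfadjoint `T` with `T = Δ⊥ T Δ⊥`:
`F* ⋄ F ≤ T` iff `F ⋄ F* ≤ T`. -/
theorem star_series_le_iff (F T : E H K →L[ℂ] E H K)
    (hT : IsSelfAdjoint T) (hTz : T = Dp H K * T * Dp H K) :
    opLe (sp (adjoint F) F) T ↔ opLe (sp F (adjoint F)) T := by
  refine ⟨opLe_sp_adjoint_of_opLe_adjoint_sp hTz, fun h => ?_⟩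
  have h' := opLe_sp_adjoint_of_opLe_adjoint_sp (F := adjoint F) hTz
  rw [adjoint_adjoint] at h'
  exact h' h

end QS
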